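/- Let T be an unrooted binary phylogenetic tree on n ≥ 2 taxa and let r ≥ 1. Then the number of convex characters on T with exactly r states equals the binomial coefficient C(2n−r−1, r−1); in particular this number depends only on n and not on the topology of T. -/

import Mathlib

open SimpleGraph

/-- The degree of a vertex in a simple graph, as the cardinality of its neighbour set. -/
noncomputable def vdeg {V : Type} (G : SimpleGraph V) (v : V) : ℕ :=
  (G.neighborSet v).ncard

/-- An unrooted binary phylogenetic tree on taxon set `X` with vertex type `V`:
a tree in which every vertex has degree 1 or 3, whose degree-1 vertices (leaves)
are bijectively labelled by the taxa in `X`. -/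
structure UnrootedBinaryTree (V X : Type) where
  graph : SimpleGraph V
  isTree : graph.IsTree
  degOneOrThree : ∀ v : V, vdeg graph v = 1 ∨ vdeg graph v = 3
  label : X → V
  label_inj : Function.Injective label
  label_leaf : ∀ x : X, vdeg graph (label x) = 1
  leaf_label : ∀ v : V, vdeg graph v = 1 → ∃ x : X, label x = v

/-- A character on `X`: a partition of `X` into nonempty blocks (the states). -/
def IsCharacter {X : Type} (P : Finset (Finset X)) : Prop :=
  (∀ B ∈ P, B.Nonempty) ∧
  (∀ B ∈ P, ∀ B' ∈ P, B ≠ B' → Disjoint B B') ∧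
  (∀ x : X, ∃ B ∈ P, x ∈ B)

/-- A character `P` is convex on `T` if states can be assigned to all vertices of `T`,
agreeing with `P` on the leaves, so that each state induces a connected subgraph. -/
def IsConvexChar {V X : Type} (T : UnrootedBinaryTree V X) (P : Finset (Finset X)) : Prop :=
  ∃ h : V → Finset X,
    (∀ v : V, h v ∈ P) ∧
    (∀ (x : X) (B : Finset X), B ∈ P → x ∈ B → h (T.label x) = B) ∧
    (∀ B ∈ P, (T.graph.induce {v : V | h v = B}).Connected)

/-- `gCount T k r` : the number of convex characters on `T` with exactly `r` states,
each state appearing on at least `k` taxa. -/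
noncomputable def gCount {V X : Type} (T : UnrootedBinaryTree V X) (k r : ℕ) : ℕ :=
  Nat.card {P : Finset (Finset X) //
    IsCharacter P ∧ IsConvexChar T P ∧ P.card = r ∧ ∀ B ∈ P, k ≤ B.card}

/-- `gTotal T k = ∑_{r=1}^{n} gCount T k r`, where `n` is the number of taxa. -/
noncomputable def gTotal {V X : Type} (T : UnrootedBinaryTree V X) (k : ℕ) : ℕ :=
  ∑ r ∈ Finset.Icc 1 (Nat.card X), gCount T k r

/-- The vertex set of the minimal connecting subtree of a set `A` of taxa:
the union of the vertex sets of all paths between pairs of leaves labelled by `A`. -/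
def connSubtree {V X : Type} (T : UnrootedBinaryTree V X) (A : Set X) : Set V :=
  {v : V | ∃ x ∈ A, ∃ y ∈ A,
    ∃ p : T.graph.Walk (T.label x) (T.label y), p.IsPath ∧ v ∈ p.support}

/-- Isomorphism of phylogenetic trees on the same taxon set, fixing each taxon. -/
def PhyloIsomorphic {V₁ V₂ X : Type}
    (T₁ : UnrootedBinaryTree V₁ X) (T₂ : UnrootedBinaryTree V₂ X) : Prop :=
  ∃ e : T₁.graph ≃g T₂.graph, ∀ x : X, e (T₁.label x) = T₂.label x


section Comb
open Classical

/-- target counting function -/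
def fcount : ℕ → ℕ → ℕ
  | 0, 0 => 1
  | 0, _ + 1 => 0
  | _ + 1, 0 => 0
  | n + 1, r + 1 => Nat.choose (2 * n - r) r

lemma fcount_rec (n r : ℕ) :
    fcount (n + 2) (r + 2) + fcount n r =
      fcount (n + 1) (r + 2) + fcount (n + 1) (r + 1) + fcount (n + 1) (r + 1) := by
  rcases n with _ | k
  · rcases r with _ | s
    · decide
    · simp only [fcount]
      have h1 : 2 * (0 + 1) - (s + 1 + 1) = 0 := by omega
      have h2 : 2 * 0 - (s + 1 + 1) = 0 := by omega
      have h3 : 2 * 0 - (s + 1) = 0 := by omega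
      rw [h1, h2, h3]
      simp
  · rcases r with _ | s
    · simp only [fcount]
      simp
      omega
    · simp only [fcount]
      by_cases hs : s ≤ 2 * k
      · obtain ⟨m, hm⟩ := Nat.exists_eq_add_of_le hs
        have h1 : 2 * (k + 1 + 1) - (s + 1 + 1) = m + 2 := by omega
        have h2 : 2 * k - s = m := by omega
        have h3 : 2 * (k + 1) - (s + 1 + 1) = m := by omega
        have h4 : 2 * (k + 1) - (s + 1) = m + 1 := by omega
        rw [h1, h2, h3, h4]
        have e1 := Nat.choose_succ_succ (m + 1) (s + 1)
        have e2 := Nat.choose_succ_succ m (s + 1)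
        have e3 := Nat.choose_succ_succ m s
        simp only [Nat.succ_eq_add_one] at e1 e2 e3
        have e4 : (m + 2).choose (s + 1 + 1) = (m + 1 + 1).choose (s + 1 + 1) := rfl
        simp only [add_assoc, Nat.reduceAdd] at e1 e2 e3 e4 ⊢
        omega
      · rw [Nat.choose_eq_zero_of_lt (by omega), Nat.choose_eq_zero_of_lt (by omega),
          Nat.choose_eq_zero_of_lt (by omega), Nat.choose_eq_zero_of_lt (by omega)]

variable {X : Type}

/-- `P` is a partition of `Y` into blocks that do not interfere -/
def GoodPart (I : X → X → X → X → Prop) (Y : Finset X) (P : Finset (Finset X)) : Prop :=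
  (∀ B ∈ P, B.Nonempty) ∧ (∀ x, x ∈ Y ↔ ∃ B ∈ P, x ∈ B) ∧
  (∀ A ∈ P, ∀ B ∈ P, ∀ x ∈ A, ∀ x' ∈ A, ∀ y ∈ B, ∀ y' ∈ B, I x x' y y' → A = B)

noncomputable def gparts (I : X → X → X → X → Prop) (Y : Finset X) (r : ℕ) :
    Finset (Finset (Finset X)) :=
  Y.powerset.powerset.filter (fun P => GoodPart I Y P ∧ P.card = r)

lemma mem_gparts {I : X → X → X → X → Prop} {Y : Finset X} {r : ℕ} {P : Finset (Finset X)} :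
    P ∈ gparts I Y r ↔ GoodPart I Y P ∧ P.card = r := by
  simp only [gparts, Finset.mem_filter, Finset.mem_powerset, and_iff_right_iff_imp]
  rintro ⟨h, -⟩ B hB
  rw [Finset.mem_powerset]
  intro x hx
  exact (h.2.1 x).2 ⟨B, hB, hx⟩

/-- the axioms on the interference relation, on the ground set -/
structure LeafLike (I : X → X → X → X → Prop) : Prop where
  refl : ∀ a b c, I a b a c
  refl' : ∀ a b c, I b a a c
  swap : ∀ a b c d, I a b c d → I b a c d
  symm : ∀ a b c d, I a b c d → I c d a b
  leaf : ∀ a c d, a ≠ c → a ≠ d → ¬ I a a c d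

structure IsCherry (I : X → X → X → X → Prop) (Y : Finset X) (a b : X) : Prop where
  ha : a ∈ Y
  hb : b ∈ Y
  ne : a ≠ b
  c1 : ∀ c ∈ Y, ∀ d ∈ Y, c ≠ a → c ≠ b → d ≠ a → d ≠ b → ¬ I a b c d
  c2 : ∀ c ∈ Y, ∀ d ∈ Y, c ≠ a → c ≠ b → d ≠ a → d ≠ b → I a c b d
  c3 : ∀ c ∈ Y, ∀ e ∈ Y, ∀ f ∈ Y, c ≠ a → c ≠ b → e ≠ a → e ≠ b → f ≠ a → f ≠ b →
    (I b c e f → I a c e f)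

lemma GoodPart.uniq {I : X → X → X → X → Prop} (hI : LeafLike I) {Y : Finset X}
    {P : Finset (Finset X)} (h : GoodPart I Y P) {A B : Finset X} (hA : A ∈ P) (hB : B ∈ P)
    {x : X} (hxA : x ∈ A) (hxB : x ∈ B) : A = B :=
  h.2.2 A hA B hB x hxA x hxA x hxB x hxB (hI.refl _ _ _)

lemma GoodPart.sub {I : X → X → X → X → Prop} {Y : Finset X}
    {P : Finset (Finset X)} (h : GoodPart I Y P) {A : Finset X} (hA : A ∈ P)
    {x : X} (hxA : x ∈ A) : x ∈ Y := (h.2.1 x).2 ⟨A, hA, hxA⟩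

lemma good_insert {I : X → X → X → X → Prop} (hI : LeafLike I) {Y : Finset X} {a : X}
    (ha : a ∈ Y) {Q : Finset (Finset X)} (h : GoodPart I (Y.erase a) Q) :
    GoodPart I Y (insert {a} Q) := by
  refine ⟨?_, ?_, ?_⟩
  · intro B hB
    rcases Finset.mem_insert.1 hB with rfl | hB
    · simp
    · exact h.1 B hB
  · intro x
    by_cases hx : x = a
    · subst hx; simp [ha]
    · have := h.2.1 x
      simp only [Finset.mem_erase, ne_eq, hx, not_false_eq_true, true_and] at this
      rw [this]; simp [hx]
  · intro A hA B hB x hx x' hx' y hy y' hy' hh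
    have key : ∀ B ∈ Q, ∀ y ∈ B, y ≠ a := fun B hB y hy =>
      (Finset.mem_erase.1 (h.sub hB hy)).1
    rcases Finset.mem_insert.1 hA with hAe | hA' <;> rcases Finset.mem_insert.1 hB with hBe | hB'
    · rw [hAe, hBe]
    · subst hAe
      simp only [Finset.mem_singleton] at hx hx'
      subst hx; subst hx'
      exact absurd hh (hI.leaf _ _ _ (key B hB' y hy).symm (key B hB' y' hy').symm)
    · subst hBe
      simp only [Finset.mem_singleton] at hy hy'
      subst hy; subst hy'
      exact absurd (hI.symm _ _ _ _ hh)
        (hI.leaf _ _ _ (key A hA' x hx).symm (key A hA' x' hx').symm)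
    · exact h.2.2 A hA' B hB' x hx x' hx' y hy y' hy' hh

lemma good_erase {I : X → X → X → X → Prop} (hI : LeafLike I) {Y : Finset X} {a : X}
    {P : Finset (Finset X)} (h : GoodPart I Y P) (ha : {a} ∈ P) :
    GoodPart I (Y.erase a) (P.erase {a}) := by
  refine ⟨fun B hB => h.1 B (Finset.mem_of_mem_erase hB), ?_, ?_⟩
  · intro x
    rw [Finset.mem_erase, h.2.1 x]
    constructor
    · rintro ⟨hx, B, hB, hxB⟩
      refine ⟨B, Finset.mem_erase.2 ⟨?_, hB⟩, hxB⟩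
      rintro rfl
      exact hx (Finset.mem_singleton.1 hxB)
    · rintro ⟨B, hB, hxB⟩
      obtain ⟨hne, hB'⟩ := Finset.mem_erase.1 hB
      refine ⟨?_, B, hB', hxB⟩
      rintro rfl
      exact hne (h.uniq hI hB' ha hxB (by simp))
  · intro A hA B hB
    exact h.2.2 A (Finset.mem_of_mem_erase hA) B (Finset.mem_of_mem_erase hB)

lemma not_mem_of_good {I : X → X → X → X → Prop} {Y : Finset X} {a : X}
    {Q : Finset (Finset X)} (h : GoodPart I (Y.erase a) Q) : {a} ∉ Q := by
  intro hh
  have := h.sub hh (Finset.mem_singleton_self a)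
  simp at this

/-- removing a singleton block, with a side condition stable under this operation -/
lemma card_single {I : X → X → X → X → Prop} (hI : LeafLike I) {Y : Finset X} {a : X}
    (ha : a ∈ Y) (r : ℕ) (q : Finset (Finset X) → Prop)
    (hq : ∀ Q, q (insert {a} Q) ↔ q Q) :
    ((gparts I Y (r + 1)).filter (fun P => {a} ∈ P ∧ q P)).card =
      ((gparts I (Y.erase a) r).filter q).card := by
  refine Finset.card_bij' (fun P _ => P.erase {a}) (fun Q _ => insert {a} Q) ?_ ?_ ?_ ?_
  · intro P hP
    simp only [Finset.mem_filter, mem_gparts] at hP ⊢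
    obtain ⟨⟨h, hc⟩, haP, hqP⟩ := hP
    refine ⟨⟨good_erase hI h haP, ?_⟩, ?_⟩
    · rw [Finset.card_erase_of_mem haP, hc]; rfl
    · rw [← hq, Finset.insert_erase haP]; exact hqP
  · intro Q hQ
    simp only [Finset.mem_filter, mem_gparts] at hQ ⊢
    obtain ⟨⟨h, hc⟩, hqQ⟩ := hQ
    refine ⟨⟨good_insert hI ha h, ?_⟩, by simp, (hq _).2 hqQ⟩
    rw [Finset.card_insert_of_notMem (not_mem_of_good h), hc]
  · intro P hP
    simp only [Finset.mem_filter] at hP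
    exact Finset.insert_erase hP.2.1
  · intro Q hQ
    simp only [Finset.mem_filter, mem_gparts] at hQ
    exact Finset.erase_insert (not_mem_of_good hQ.1.1)

/-- add `b` to the block of `a` -/
noncomputable def addTo (a b : X) (B : Finset X) : Finset X := if a ∈ B then insert b B else B

lemma mem_addTo {a b x : X} {B : Finset X} : x ∈ addTo a b B ↔ x ∈ B ∨ (x = b ∧ a ∈ B) := by
  unfold addTo
  split_ifs with h <;> simp [h, or_comm]

lemma card_same {I : X → X → X → X → Prop} (hI : LeafLike I) {Y : Finset X} {a b : X}
    (hab : IsCherry I Y a b) (r : ℕ) :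
    ((gparts I Y r).filter (fun P => ∃ B ∈ P, a ∈ B ∧ b ∈ B)).card =
      (gparts I (Y.erase b) r).card := by
  have hne := hab.ne
  have hiff : ∀ P, GoodPart I Y P → (∃ B ∈ P, a ∈ B ∧ b ∈ B) → ∀ B ∈ P, a ∈ B ↔ b ∈ B := by
    rintro P hP ⟨C, hC, haC, hbC⟩ B hB
    constructor
    · intro h; rw [hP.uniq hI hB hC h haC]; exact hbC
    · intro h; rw [hP.uniq hI hB hC h hbC]; exact haC
  have hae : ∀ Q, GoodPart I (Y.erase b) Q → ∀ B ∈ Q, (addTo a b B).erase b = B := by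
    intro Q hQ B hB
    have hb : b ∉ B := fun h => by simpa using hQ.sub hB h
    ext x
    rw [Finset.mem_erase, mem_addTo]
    by_cases hx : x = b
    · subst hx; simp [hb]
    · simp [hx]
  have hea : ∀ P, GoodPart I Y P → (∃ B ∈ P, a ∈ B ∧ b ∈ B) → ∀ B ∈ P,
      addTo a b (B.erase b) = B := by
    intro P hP hs B hB
    have := hiff P hP hs B hB
    ext x
    rw [mem_addTo, Finset.mem_erase, Finset.mem_erase]
    by_cases hx : x = b
    · subst hx; simp [hne, this]
    · simp [hx]
  refine Finset.card_bij' (fun P _ => P.image (fun B => B.erase b))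
    (fun Q _ => Q.image (addTo a b)) ?_ ?_ ?_ ?_
  · intro P hP
    simp only [Finset.mem_filter, mem_gparts] at hP ⊢
    obtain ⟨⟨h, hc⟩, hs⟩ := hP
    refine ⟨⟨?_, ?_, ?_⟩, ?_⟩
    · simp only [Finset.forall_mem_image]
      intro B hB
      by_cases haB : a ∈ B
      · exact ⟨a, Finset.mem_erase.2 ⟨hne, haB⟩⟩
      · obtain ⟨x, hx⟩ := h.1 B hB
        refine ⟨x, Finset.mem_erase.2 ⟨?_, hx⟩⟩
        rintro rfl
        exact haB ((hiff P h hs B hB).2 hx)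
    · intro x
      simp only [Finset.mem_erase, Finset.exists_mem_image, h.2.1 x]
      constructor
      · rintro ⟨h1, B, hB, h2⟩; exact ⟨B, hB, h1, h2⟩
      · rintro ⟨B, hB, h1, h2⟩; exact ⟨h1, B, hB, h2⟩
    · simp only [Finset.forall_mem_image]
      intro A hA B hB x hx x' hx' y hy y' hy' hh
      rw [h.2.2 A hA B hB x (Finset.mem_of_mem_erase hx) x' (Finset.mem_of_mem_erase hx')
        y (Finset.mem_of_mem_erase hy) y' (Finset.mem_of_mem_erase hy') hh]
    · rw [Finset.card_image_of_injOn, hc]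
      intro A hA B hB hAB
      rw [← hea P h hs A hA, ← hea P h hs B hB]
      exact congrArg _ hAB
  · intro Q hQ
    simp only [Finset.mem_filter, mem_gparts] at hQ ⊢
    obtain ⟨h, hc⟩ := hQ
    have haY : a ∈ Y.erase b := Finset.mem_erase.2 ⟨hne, hab.ha⟩
    obtain ⟨C, hC, haC⟩ := (h.2.1 a).1 haY
    have hbn : ∀ B ∈ Q, b ∉ B := fun B hB hb => by simpa using h.sub hB hb
    -- the asymmetric core of compatibility
    have core : ∀ A ∈ Q, ∀ B ∈ Q, A ≠ B → a ∉ B → ∀ x ∈ addTo a b A, ∀ x' ∈ addTo a b A,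
        ∀ y ∈ B, ∀ y' ∈ B, ¬ I x x' y y' := by
      intro A hA B hB hAB haB x hx x' hx' y hy y' hy' hh
      have ya : y ≠ a := fun e => haB (e ▸ hy)
      have ya' : y' ≠ a := fun e => haB (e ▸ hy')
      have yb : y ≠ b := fun e => hbn B hB (e ▸ hy)
      have yb' : y' ≠ b := fun e => hbn B hB (e ▸ hy')
      have yY : y ∈ Y := Finset.mem_of_mem_erase (h.sub hB hy)
      have yY' : y' ∈ Y := Finset.mem_of_mem_erase (h.sub hB hy')
      rw [mem_addTo] at hx hx'
      have one : ∀ c ∈ A, a ∈ A → ¬ I b c y y' := by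
        intro c hc haA hh
        by_cases hca : c = a
        · subst hca
          exact hab.c1 y yY y' yY' ya yb ya' yb' (hI.swap _ _ _ _ hh)
        · have hcb : c ≠ b := fun e => hbn A hA (e ▸ hc)
          have cY : c ∈ Y := Finset.mem_of_mem_erase (h.sub hA hc)
          exact hAB (h.2.2 A hA B hB a haA c hc y hy y' hy'
            (hab.c3 c cY y yY y' yY' hca hcb ya yb ya' yb' hh))
      rcases hx with hx | ⟨rfl, haA⟩ <;> rcases hx' with hx' | ⟨hx', haA'⟩
      · exact hAB (h.2.2 A hA B hB x hx x' hx' y hy y' hy' hh)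
      · subst hx'; exact one x hx haA' (hI.swap _ _ _ _ hh)
      · exact one x' hx' haA hh
      · subst hx'; exact hI.leaf _ _ _ yb.symm yb'.symm hh
    have nota : ∀ B, a ∉ B → addTo a b B = B := fun B hB => by simp [addTo, hB]
    refine ⟨⟨⟨?_, ?_, ?_⟩, ?_⟩, ?_⟩
    · simp only [Finset.forall_mem_image]
      intro B hB
      obtain ⟨x, hx⟩ := h.1 B hB
      exact ⟨x, mem_addTo.2 (Or.inl hx)⟩
    · intro x
      simp only [Finset.exists_mem_image, mem_addTo]
      by_cases hx : x = b
      · subst hx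
        simp only [hab.hb, true_iff]
        exact ⟨C, hC, Or.inr (by simpa using haC)⟩
      · have := h.2.1 x
        simp only [Finset.mem_erase, ne_eq, hx, not_false_eq_true, true_and] at this
        simp [hx, this]
    · simp only [Finset.forall_mem_image]
      intro A hA B hB x hx x' hx' y hy y' hy' hh
      by_cases hAB : A = B
      · rw [hAB]
      exfalso
      by_cases haB : a ∈ B
      · have haA : a ∉ A := fun h' => hAB (h.uniq hI hA hB h' haB)
        rw [nota A haA] at hx hx'
        exact core B hB A hA (Ne.symm hAB) haA y hy y' hy' x hx x' hx' (hI.symm _ _ _ _ hh)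
      · rw [nota B haB] at hy hy'
        exact core A hA B hB hAB haB x hx x' hx' y hy y' hy' hh
    · rw [Finset.card_image_of_injOn, hc]
      intro A hA B hB hAB
      rw [← hae Q h A hA, ← hae Q h B hB]
      exact congrArg (fun Z => Finset.erase Z b) hAB
    · exact ⟨addTo a b C, Finset.mem_image_of_mem _ hC, mem_addTo.2 (Or.inl haC),
        mem_addTo.2 (Or.inr ⟨rfl, haC⟩)⟩
  · intro P hP
    simp only [Finset.mem_filter, mem_gparts] at hP
    simp only [Finset.image_image]
    conv_rhs => rw [← Finset.image_id (s := P)]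
    exact Finset.image_congr (fun B hB => hea P hP.1.1 hP.2 B hB)
  · intro Q hQ
    simp only [mem_gparts] at hQ
    simp only [Finset.image_image]
    conv_rhs => rw [← Finset.image_id (s := Q)]
    exact Finset.image_congr (fun B hB => hae Q hQ.1 B hB)

lemma cherry_split {I : X → X → X → X → Prop} {Y : Finset X} {a b : X}
    (hab : IsCherry I Y a b) {P : Finset (Finset X)} (h : GoodPart I Y P)
    (hns : ¬ ∃ B ∈ P, a ∈ B ∧ b ∈ B) : {a} ∈ P ∨ {b} ∈ P := by
  obtain ⟨A, hA, haA⟩ := (h.2.1 a).1 hab.ha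
  obtain ⟨B, hB, hbB⟩ := (h.2.1 b).1 hab.hb
  have hbA : b ∉ A := fun h' => hns ⟨A, hA, haA, h'⟩
  have haB : a ∉ B := fun h' => hns ⟨B, hB, h', hbB⟩
  by_contra hcon
  push Not at hcon
  have h1 : ∃ c ∈ A, c ≠ a := by
    by_contra hc
    push Not at hc
    exact hcon.1 ((Finset.eq_singleton_iff_unique_mem.2 ⟨haA, hc⟩) ▸ hA)
  have h2 : ∃ c ∈ B, c ≠ b := by
    by_contra hc
    push Not at hc
    exact hcon.2 ((Finset.eq_singleton_iff_unique_mem.2 ⟨hbB, hc⟩) ▸ hB)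
  obtain ⟨c, hc, hca⟩ := h1
  obtain ⟨d, hd, hdb⟩ := h2
  have := h.2.2 A hA B hB a haA c hc b hbB d hd
    (hab.c2 c (h.sub hA hc) d (h.sub hB hd) hca (fun e => hbA (e ▸ hc)) (fun e => haB (e ▸ hd)) hdb)
  exact hbA (this ▸ hbB)

lemma gparts_zero {I : X → X → X → X → Prop} {Y : Finset X} (hY : Y.Nonempty) :
    (gparts I Y 0).card = 0 := by
  rw [Finset.card_eq_zero, Finset.eq_empty_iff_forall_notMem]
  intro P hP
  obtain ⟨h, hc⟩ := mem_gparts.1 hP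
  obtain ⟨x, hx⟩ := hY
  obtain ⟨B, hB, -⟩ := (h.2.1 x).1 hx
  rw [Finset.card_eq_zero.1 hc] at hB
  simp at hB

lemma gparts_rec {I : X → X → X → X → Prop} (hI : LeafLike I) {Y : Finset X} {a b : X}
    (hab : IsCherry I Y a b) (r : ℕ) :
    (gparts I Y (r + 1)).card +
        ((gparts I (Y.erase a) r).filter (fun P => {b} ∈ P)).card =
      (gparts I (Y.erase b) (r + 1)).card + (gparts I (Y.erase a) r).card +
        (gparts I (Y.erase b) r).card := by
  have hne := hab.ne
  have e1 := card_same hI hab (r + 1)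
  have e2 := card_single hI hab.ha r (fun _ => True) (by simp)
  have e3 := card_single hI hab.hb r (fun _ => True) (by simp)
  have e4 : ((gparts I Y (r + 1)).filter (fun P => {a} ∈ P ∧ {b} ∈ P)).card =
      ((gparts I (Y.erase a) r).filter (fun P => {b} ∈ P)).card := by
    have e5 := card_single hI hab.ha r (fun P => {b} ∈ P) (by
      intro Q; simp only [Finset.mem_insert, Finset.singleton_inj, or_iff_right_iff_imp]
      intro h; exact absurd h.symm hne)
    convert e5
  simp only [and_true, Finset.filter_true] at e2 e3
  have e5 := Finset.card_union_add_card_inter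
    ((gparts I Y (r + 1)).filter (fun P => {a} ∈ P))
    ((gparts I Y (r + 1)).filter (fun P => {b} ∈ P))
  rw [← Finset.filter_and, ← Finset.filter_or] at e5
  have e6 : (gparts I Y (r + 1)).card =
      ((gparts I Y (r + 1)).filter (fun P => ∃ B ∈ P, a ∈ B ∧ b ∈ B)).card +
      ((gparts I Y (r + 1)).filter (fun P => {a} ∈ P ∨ {b} ∈ P)).card := by
    rw [← Finset.card_union_of_disjoint, ← Finset.filter_or]
    · congr 1
      rw [Finset.filter_true_of_mem]
      intro P hP
      by_cases hs : ∃ B ∈ P, a ∈ B ∧ b ∈ B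
      · exact Or.inl hs
      · exact Or.inr (cherry_split hab (mem_gparts.1 hP).1 hs)
    · rw [Finset.disjoint_filter]
      rintro P hP ⟨B, hB, h1, h2⟩ hh
      have hg := (mem_gparts.1 hP).1
      rcases hh with hh | hh
      · have := hg.uniq hI hB hh h1 (by simp)
        rw [this] at h2; simp at h2; exact hne h2.symm
      · have := hg.uniq hI hB hh h2 (by simp)
        rw [this] at h1; simp at h1; exact hne h1
  rw [← e4, ← e1, ← e2, ← e3, add_assoc, ← e5, ← add_assoc, ← e6]

lemma gparts_empty {I : X → X → X → X → Prop} (r : ℕ) :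
    (gparts I ∅ r).card = fcount 0 r := by
  have : ∀ P, GoodPart I ∅ P ↔ P = ∅ := by
    intro P
    constructor
    · intro h
      rw [Finset.eq_empty_iff_forall_notMem]
      intro B hB
      obtain ⟨x, hx⟩ := h.1 B hB
      simpa using h.sub hB hx
    · rintro rfl
      simp [GoodPart]
  rcases r with _ | r
  · have : gparts I ∅ 0 = {∅} := by
      ext P; rw [mem_gparts, this]; simp
    rw [this]; rfl
  · have : gparts I ∅ (r + 1) = ∅ := by
      ext P; rw [mem_gparts, this]; simp; rintro rfl; simp
    rw [this]; rfl

lemma gparts_single {I : X → X → X → X → Prop} (hI : LeafLike I) (a : X) (r : ℕ) :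
    (gparts I {a} r).card = fcount 1 r := by
  rcases r with _ | r
  · exact gparts_zero (by simp)
  · have e2 := card_single hI (Finset.mem_singleton_self a) r (fun _ => True) (by simp)
    simp only [and_true, Finset.filter_true, Finset.erase_singleton] at e2
    rw [gparts_empty] at e2
    rw [Finset.filter_true_of_mem] at e2
    · rw [e2]
      rcases r with _ | r <;> simp [fcount]
    · intro P hP
      have hg := (mem_gparts.1 hP).1
      obtain ⟨B, hB, haB⟩ := (hg.2.1 a).1 (by simp)
      have : B = {a} := Finset.eq_singleton_iff_unique_mem.2
        ⟨haB, fun x hx => by simpa using hg.sub hB hx⟩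
      exact this ▸ hB

theorem gparts_card {I : X → X → X → X → Prop} (hI : LeafLike I)
    (hch : ∀ Y : Finset X, 2 ≤ Y.card → ∃ a b, IsCherry I Y a b) (n : ℕ) :
    ∀ (Y : Finset X) (r : ℕ), Y.card = n → (gparts I Y r).card = fcount n r := by
  induction n using Nat.strong_induction_on with
  | _ n ih =>
    intro Y r hY
    rcases n with _ | _ | n
    · rw [Finset.card_eq_zero.1 hY]; exact gparts_empty r
    · obtain ⟨a, rfl⟩ := Finset.card_eq_one.1 hY
      exact gparts_single hI a r
    · obtain ⟨a, b, hab⟩ := hch Y (by omega)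
      have hne := hab.ne
      have ca : (Y.erase a).card = n + 1 := by rw [Finset.card_erase_of_mem hab.ha]; omega
      have cb : (Y.erase b).card = n + 1 := by rw [Finset.card_erase_of_mem hab.hb]; omega
      have hba : b ∈ Y.erase a := Finset.mem_erase.2 ⟨hne.symm, hab.hb⟩
      have cab : ((Y.erase a).erase b).card = n := by
        rw [Finset.card_erase_of_mem hba]; omega
      rcases r with _ | r
      · rw [gparts_zero ⟨a, hab.ha⟩]; rfl
      · have hrec := gparts_rec hI hab r
        rw [ih (n + 1) (by omega) _ _ ca, ih (n + 1) (by omega) _ _ cb,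
          ih (n + 1) (by omega) _ _ cb] at hrec
        rcases r with _ | r
        · have : ((gparts I (Y.erase a) 0).filter (fun P => {b} ∈ P)).card = 0 := by
            rw [Finset.card_eq_zero, Finset.card_eq_zero.1 (gparts_zero ⟨b, hba⟩)]
            simp
          rw [this] at hrec
          simp [fcount] at hrec ⊢
          exact hrec
        · have e3 := card_single hI hba r (fun _ => True) (by simp)
          simp only [and_true, Finset.filter_true] at e3
          rw [e3, ih n (by omega) _ _ cab] at hrec
          have := fcount_rec n r
          simp only [add_assoc, Nat.reduceAdd] at this hrec ⊢
          omega

end Comb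

section TreeBtw

variable {V : Type} {G : SimpleGraph V}

/-- `v` lies on every walk from `a` to `b` -/
def TBtw (G : SimpleGraph V) (a v b : V) : Prop := ∀ p : G.Walk a b, v ∈ p.support

lemma btw_left (a b : V) : TBtw G a a b := fun p => p.start_mem_support
lemma btw_right (a b : V) : TBtw G a b b := fun p => p.end_mem_support

lemma TBtw.symm {a v b : V} (h : TBtw G a v b) : TBtw G b v a := fun p => by
  have := h p.reverse
  simpa using this

lemma TBtw.split {a v b : V} (h : TBtw G a v b) (c : V) : TBtw G a v c ∨ TBtw G c v b := by
  by_contra hc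
  simp only [TBtw, not_or, not_forall] at hc
  obtain ⟨⟨p, hp⟩, ⟨q, hq⟩⟩ := hc
  have := h (p.append q)
  rw [Walk.mem_support_append_iff] at this
  tauto

lemma TBtw.trans {b m c w : V} (h : TBtw G b m c) (h' : TBtw G m w c) : TBtw G b w c := by
  classical
  intro p
  exact Walk.support_dropUntil_subset_support _ (h p) (h' (p.dropUntil m (h p)))

lemma TBtw.trans' {b m c w : V} (h : TBtw G b m c) (h' : TBtw G b w m) : TBtw G b w c :=
  (h.symm.trans h'.symm).symm

lemma TBtw.antisymm (hG : G.IsTree) {a w m : V} (h : TBtw G a w m) (h' : TBtw G a m w) : w = m := by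
  classical
  obtain ⟨p, hp, -⟩ := hG.existsUnique_path a m
  by_contra hne
  exact Walk.endpoint_notMem_support_takeUntil hp (h p) (fun e => hne e.symm) (h' _)

lemma TBtw.eq_of_self {a v : V} (h : TBtw G a v a) : v = a := by
  simpa using h Walk.nil

lemma exists_next (hG : G.IsTree) {m a : V} (hne : m ≠ a) : ∃ n, G.Adj m n ∧ TBtw G m n a := by
  classical
  obtain ⟨p, hp, hu⟩ := hG.existsUnique_path m a
  cases p with
  | nil => exact absurd rfl hne
  | @cons _ n _ h p' =>
    refine ⟨n, h, fun q => ?_⟩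
    have := hu q.bypass q.bypass_isPath
    apply q.support_bypass_subset_support
    rw [this]
    simp

/-- the next vertex differs from the previous vertex -/
lemma next_ne (hG : G.IsTree) {r p m n a : V} (hp : G.Adj m p) (h1 : TBtw G r p m)
    (h2 : TBtw G r m a) (h3 : TBtw G m n a) : n ≠ p := by
  rintro rfl
  rcases h2.split n with h | h
  · exact hp.ne ((h1.antisymm hG h).symm)
  · exact hp.ne (h.symm.antisymm hG h3.symm)

lemma next_below (hG : G.IsTree) {r m n a : V} (hn : G.Adj m n)
    (h2 : TBtw G r m a) (h3 : TBtw G m n a) : TBtw G r m n := by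
  rcases h2.split n with h | h
  · exact h
  · exact absurd (h.symm.antisymm hG h3.symm) hn.ne

lemma vdeg_one_unique {v x y : V} (h : vdeg G v = 1) (hx : G.Adj v x) (hy : G.Adj v y) : x = y := by
  obtain ⟨z, hz⟩ := Set.ncard_eq_one.1 h
  have h1 : x ∈ G.neighborSet v := hx
  have h2 : y ∈ G.neighborSet v := hy
  rw [hz] at h1 h2
  exact h1.trans h2.symm

/-- leaves are not interior to paths -/
lemma leaf_not_btw (hG : G.IsTree) {a c d : V} (ha : vdeg G a = 1) (hc : a ≠ c) (hd : a ≠ d) :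
    ¬ TBtw G c a d := by
  intro h
  obtain ⟨p, hp, hp'⟩ := exists_next hG hc
  obtain ⟨n, hn, hn'⟩ := exists_next hG hd
  exact next_ne hG hp hp'.symm h hn' (vdeg_one_unique ha hn hp)

variable [Finite V]

/-- cherries exist -/
lemma exists_cherry_vertex (hG : G.IsTree) (hdeg : ∀ v, vdeg G v = 1 ∨ vdeg G v = 3)
    (Y : Set V) (hleaf : ∀ v ∈ Y, vdeg G v = 1) (r : V) (hr : r ∈ Y)
    (h3 : ∃ a ∈ Y, ∃ b ∈ Y, a ≠ b ∧ a ≠ r ∧ b ≠ r) :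
    ∃ m, ∃ a ∈ Y, ∃ b ∈ Y, a ≠ b ∧ a ≠ r ∧ b ≠ r ∧ TBtw G r m a ∧ TBtw G r m b ∧
      ∀ c ∈ Y, c ≠ a → c ≠ b → ¬ TBtw G r m c := by
  classical
  let S : Set V := {m | ∃ a ∈ Y, ∃ b ∈ Y, a ≠ b ∧ a ≠ r ∧ b ≠ r ∧ TBtw G r m a ∧ TBtw G r m b}
  have hS : S.Nonempty := by
    obtain ⟨a, ha, b, hb, h⟩ := h3
    exact ⟨r, a, ha, b, hb, h.1, h.2.1, h.2.2, btw_left _ _, btw_left _ _⟩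
  obtain ⟨m, hmS, hmax⟩ := Set.exists_max_image S (fun m => {v | TBtw G r v m}.ncard)
    (Set.toFinite _) hS
  -- no common next vertex
  have hno : ∀ n, G.Adj m n → TBtw G r m n → n ∉ S := by
    intro n hn hmn hnS
    have := hmax n hnS
    refine absurd this (not_le.2 (Set.ncard_lt_ncard ?_ (Set.toFinite _)))
    refine ⟨fun v hv => hmn.trans' hv, fun h => ?_⟩
    have : TBtw G r n m := h (btw_right r n)
    exact hn.ne (hmn.antisymm hG this)
  have hno2 : ∀ a ∈ Y, ∀ b ∈ Y, a ≠ b → a ≠ r → b ≠ r → TBtw G r m a → TBtw G r m b →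
      ∀ n, G.Adj m n → TBtw G m n a → ¬ TBtw G m n b := by
    intro a ha b hb hab har hbr hma hmb n hn hna hnb
    exact hno n hn (next_below hG hn hma hna) ⟨a, ha, b, hb, hab, har, hbr,
      hma.trans hna, hmb.trans hnb⟩
  obtain ⟨a, ha, b, hb, hab, har, hbr, hma, hmb⟩ := hmS
  have hmY : ∀ a ∈ Y, ∀ b ∈ Y, a ≠ b → a ≠ r → b ≠ r → TBtw G r m b → m ≠ a := by
    rintro a ha b hb hab har hbr hmb rfl
    exact leaf_not_btw hG (hleaf m ha) har hab hmb
  have hmr : m ≠ r := by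
    rintro rfl
    obtain ⟨n, hn, hna⟩ := exists_next hG har.symm
    obtain ⟨n', hn', hnb⟩ := exists_next hG hbr.symm
    have := vdeg_one_unique (hleaf m hr) hn hn'
    subst this
    exact hno2 a ha b hb hab har hbr hma hmb n hn hna hnb
  refine ⟨m, a, ha, b, hb, hab, har, hbr, hma, hmb, ?_⟩
  intro c hc hca hcb hmc
  have hcr : c ≠ r := by
    rintro rfl
    exact hmr hmc.eq_of_self
  obtain ⟨p, hp, hpm⟩ := exists_next hG hmr
  obtain ⟨x, hx, hxa⟩ := exists_next hG (hmY a ha b hb hab har hbr hmb)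
  obtain ⟨y, hy, hyb⟩ := exists_next hG (hmY b hb a ha hab.symm hbr har hma)
  obtain ⟨z, hz, hzc⟩ := exists_next hG (hmY c hc a ha hca hcr har hma)
  have e1 : x ≠ y := by
    rintro rfl; exact hno2 a ha b hb hab har hbr hma hmb x hx hxa hyb
  have e2 : x ≠ z := by
    rintro rfl; exact hno2 a ha c hc hca.symm har hcr hma hmc x hx hxa hzc
  have e3 : y ≠ z := by
    rintro rfl; exact hno2 b hb c hc hcb.symm hbr hcr hmb hmc y hy hyb hzc
  have e4 := next_ne hG hp hpm.symm hma hxa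
  have e5 := next_ne hG hp hpm.symm hmb hyb
  have e6 := next_ne hG hp hpm.symm hmc hzc
  have hsub : (({p, x, y, z} : Finset V) : Set V) ⊆ G.neighborSet m := by
    intro w hw
    simp only [Finset.coe_insert, Finset.coe_singleton, Set.mem_insert_iff,
      Set.mem_singleton_iff] at hw
    rcases hw with rfl | rfl | rfl | rfl <;> assumption
  have hcard := Set.ncard_le_ncard hsub (Set.toFinite _)
  rw [Set.ncard_coe_finset] at hcard
  have h4 : ({p, x, y, z} : Finset V).card = 4 := by
    rw [Finset.card_insert_of_notMem, Finset.card_insert_of_notMem, Finset.card_insert_of_notMem,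
      Finset.card_singleton] <;> simp [e1, e2, e3, e4.symm, e5.symm, e6.symm]
  rcases hdeg m with h | h <;> unfold vdeg at h <;> omega

end TreeBtw

section Link

variable {V X : Type}

/-- interference of two pairs of taxa: the paths between them meet -/
def PathInter (T : UnrootedBinaryTree V X) (a b c d : X) : Prop :=
  ∃ v, TBtw T.graph (T.label a) v (T.label b) ∧ TBtw T.graph (T.label c) v (T.label d)

lemma inter_leafLike (T : UnrootedBinaryTree V X) : LeafLike (PathInter T) where
  refl a b c := ⟨_, btw_left _ _, btw_left _ _⟩
  refl' a b c := ⟨_, btw_right _ _, btw_left _ _⟩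
  swap := fun a b c d ⟨v, h1, h2⟩ => ⟨v, h1.symm, h2⟩
  symm := fun a b c d ⟨v, h1, h2⟩ => ⟨v, h2, h1⟩
  leaf := by
    rintro a c d hc hd ⟨v, h1, h2⟩
    rw [h1.eq_of_self] at h2
    exact leaf_not_btw T.isTree (T.label_leaf a) (fun e => hc (T.label_inj e))
      (fun e => hd (T.label_inj e)) h2

lemma inter_cherry [Finite V] (T : UnrootedBinaryTree V X) (Y : Finset X) (hY : 2 ≤ Y.card) :
    ∃ a b, IsCherry (PathInter T) Y a b := by
  classical
  rcases hY.eq_or_lt with h2 | h3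
  · obtain ⟨a, b, hab, rfl⟩ := Finset.card_eq_two.1 h2.symm
    refine ⟨a, b, by simp, by simp, hab, ?_, ?_, ?_⟩
    · intro c hc d hd h1 h2; simp at hc; tauto
    · intro c hc d hd h1 h2; simp at hc; tauto
    · intro c hc d hd f hf h1 h2; simp at hc; tauto
  obtain ⟨r, hr, a0, ha0, b0, hb0, hra, hrb, hab0⟩ := Finset.two_lt_card.1 h3
  have hG := T.isTree
  obtain ⟨m, a', ⟨a, ha, rfl⟩, b', ⟨b, hb, rfl⟩, hab, har, hbr, hma, hmb, hother⟩ :=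
    exists_cherry_vertex T.isTree T.degOneOrThree (T.label '' (Y : Set X))
      (by rintro _ ⟨x, -, rfl⟩; exact T.label_leaf x) (T.label r) ⟨r, hr, rfl⟩
      ⟨_, ⟨a0, ha0, rfl⟩, _, ⟨b0, hb0, rfl⟩, fun e => hab0 (T.label_inj e),
        fun e => hra (T.label_inj e).symm, fun e => hrb (T.label_inj e).symm⟩
  have out : ∀ c ∈ Y, c ≠ a → c ≠ b → ¬ TBtw T.graph (T.label r) m (T.label c) := by
    intro c hc h1 h2
    exact hother _ ⟨c, hc, rfl⟩ (fun e => h1 (T.label_inj e)) (fun e => h2 (T.label_inj e))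
  -- outside taxa are not separated by m
  have out2 : ∀ c ∈ Y, ∀ d ∈ Y, c ≠ a → c ≠ b → d ≠ a → d ≠ b →
      ¬ TBtw T.graph (T.label c) m (T.label d) := by
    intro c hc d hd h1 h2 h3 h4 h
    rcases h.split (T.label r) with h | h
    · exact out c hc h1 h2 h.symm
    · exact out d hd h3 h4 h
  -- m separates inside vertices from outside taxa
  have sep : ∀ x, TBtw T.graph (T.label r) m x → ∀ c ∈ Y, c ≠ a → c ≠ b →
      TBtw T.graph x m (T.label c) := by
    intro x hx c hc h1 h2
    rcases hx.split (T.label c) with h | h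
    · exact absurd h (out c hc h1 h2)
    · exact h.symm
  have main : ∀ x, TBtw T.graph (T.label r) m x → ∀ c ∈ Y, ∀ d ∈ Y, c ≠ a → c ≠ b → d ≠ a → d ≠ b →
      ∀ w, TBtw T.graph x w m → ¬ TBtw T.graph (T.label c) w (T.label d) := by
    intro x hx c hc d hd h1 h2 h3 h4 w hw hcd
    have hwm : w ≠ m := by
      rintro rfl; exact out2 c hc d hd h1 h2 h3 h4 hcd
    have hxw : ¬ TBtw T.graph x m w := fun h => hwm (hw.antisymm hG h)
    rcases (sep x hx c hc h1 h2).split w with h | h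
    · exact hxw h
    · exact out2 c hc d hd h1 h2 h3 h4 (hcd.trans' h.symm)
  refine ⟨a, b, ha, hb, fun e => hab (by rw [e]), ?_, ?_, ?_⟩
  · rintro c hc d hd h1 h2 h3 h4 ⟨w, hw, hw'⟩
    rcases hw.split m with h | h
    · exact main _ hma c hc d hd h1 h2 h3 h4 w h hw'
    · exact main _ hmb c hc d hd h1 h2 h3 h4 w h.symm hw'
  · intro c hc d hd h1 h2 h3 h4
    exact ⟨m, sep _ hma c hc h1 h2, sep _ hmb d hd h3 h4⟩
  · rintro c hc e he f hf h1 h2 h3 h4 h5 h6 ⟨w, hw, hw'⟩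
    rcases hw.split m with h | h
    · exact absurd hw' (main _ hmb e he f hf h3 h4 h5 h6 w h)
    · exact ⟨w, (sep _ hma c hc h1 h2).trans h, hw'⟩

lemma walk_of_induce {G : SimpleGraph V} {s : Set V} {u v : s} (p : (G.induce s).Walk u v) :
    ∃ q : G.Walk (u : V) v, ∀ w ∈ q.support, w ∈ s := by
  induction p with
  | nil => exact ⟨Walk.nil, by simp⟩
  | @cons u v w h p ih =>
    obtain ⟨q, hq⟩ := ih
    refine ⟨Walk.cons (by simpa using h) q, ?_⟩
    simpa using hq

lemma connected_of_walks {G : SimpleGraph V} {s : Set V} (c : V) (hc : c ∈ s)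
    (h : ∀ v ∈ s, ∃ q : G.Walk v c, ∀ w ∈ q.support, w ∈ s) : (G.induce s).Connected := by
  have hr : ∀ v : s, (G.induce s).Reachable v ⟨c, hc⟩ := by
    rintro ⟨v, hv⟩
    obtain ⟨q, hq⟩ := h v hv
    exact ⟨q.induce s hq⟩
  have : Nonempty s := ⟨⟨c, hc⟩⟩
  exact ⟨fun u v => (hr u).trans (hr v).symm⟩

/-- partial convex colourings extend -/
lemma extend_colouring [Finite V] {G : SimpleGraph V} (hG : G.Connected) {C : Type}
    (base : C → V) (n : ℕ) : ∀ (S : Set V) (h : V → C), S.Nonempty → Sᶜ.ncard = n →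
    (∀ v ∈ S, ∃ q : G.Walk v (base (h v)), ∀ w ∈ q.support, w ∈ S ∧ h w = h v) →
    ∃ h' : V → C, (∀ v ∈ S, h' v = h v) ∧ (∀ v, ∃ u ∈ S, h' v = h u) ∧
      ∀ v, ∃ q : G.Walk v (base (h' v)), ∀ w ∈ q.support, h' w = h' v := by
  classical
  induction n with
  | zero =>
    intro S h _ hS hq
    rw [Set.ncard_eq_zero, Set.compl_empty_iff] at hS
    subst hS
    refine ⟨h, fun _ _ => rfl, fun v => ⟨v, trivial, rfl⟩, fun v => ?_⟩
    obtain ⟨q, hq⟩ := hq v trivial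
    exact ⟨q, fun w hw => (hq w hw).2⟩
  | succ n ih =>
    intro S h hne hS hq
    obtain ⟨s, hs⟩ := hne
    obtain ⟨t, ht⟩ : (Sᶜ).Nonempty := by
      rw [← Set.ncard_pos]; omega
    obtain ⟨p⟩ := hG.preconnected s t
    obtain ⟨d, -, hd1, hd2⟩ := p.exists_boundary_dart S hs ht
    have hadj := d.adj
    generalize d.fst = x at hd1 hadj
    generalize d.snd = u at hd2 hadj
    have hup : ∀ v ∈ S, Function.update h u (h x) v = h v := by
      intro v hv
      rw [Function.update_of_ne]
      rintro rfl; exact hd2 hv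
    have huu : Function.update h u (h x) u = h x := Function.update_self _ _ _
    obtain ⟨h', h1, h2, h3⟩ := ih (insert u S) (Function.update h u (h x)) ⟨s, Or.inr hs⟩ (by
        have : Sᶜ = insert u (insert u S)ᶜ := by
          ext v; by_cases hv : v = u
          · subst hv; simpa using hd2
          · simp [hv]
        rw [this, Set.ncard_insert_of_notMem (by simp)] at hS
        omega) (by
        rintro v (rfl | hv)
        · rw [huu]
          obtain ⟨q, hq⟩ := hq x hd1
          refine ⟨Walk.cons hadj.symm q, ?_⟩
          intro w hw
          rw [Walk.support_cons, List.mem_cons] at hw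
          rcases hw with rfl | hw
          · exact ⟨Or.inl rfl, huu⟩
          · obtain ⟨a1, a2⟩ := hq w hw
            exact ⟨Or.inr a1, by rw [hup w a1, a2]⟩
        · rw [hup v hv]
          obtain ⟨q, hq⟩ := hq v hv
          refine ⟨q, fun w hw => ?_⟩
          obtain ⟨a1, a2⟩ := hq w hw
          exact ⟨Or.inr a1, by rw [hup w a1, a2]⟩)
    refine ⟨h', ?_, ?_, h3⟩
    · intro v hv
      rw [h1 v (Or.inr hv), hup v hv]
    · intro v
      obtain ⟨w, hw, e⟩ := h2 v
      rcases hw with rfl | hw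
      · exact ⟨x, hd1, by rw [e, huu]⟩
      · exact ⟨w, hw, by rw [e, hup w hw]⟩

lemma good_of_convex (T : UnrootedBinaryTree V X) [Fintype X] {P : Finset (Finset X)}
    (hP : IsCharacter P) (hc : IsConvexChar T P) : GoodPart (PathInter T) Finset.univ P := by
  obtain ⟨h, -, h2, h3⟩ := hc
  refine ⟨hP.1, fun x => ⟨fun _ => hP.2.2 x, fun _ => Finset.mem_univ x⟩, ?_⟩
  have key : ∀ A ∈ P, ∀ x ∈ A, ∀ x' ∈ A, ∀ v, TBtw T.graph (T.label x) v (T.label x') → h v = A := by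
    intro A hA x hx x' hx' v hv
    obtain ⟨p⟩ := (h3 A hA).preconnected ⟨T.label x, h2 x A hA hx⟩ ⟨T.label x', h2 x' A hA hx'⟩
    obtain ⟨q, hq⟩ := walk_of_induce p
    exact hq v (hv q)
  rintro A hA B hB x hx x' hx' y hy y' hy' ⟨v, hv, hv'⟩
  rw [← key A hA x hx x' hx' v hv, ← key B hB y hy y' hy' v hv']

lemma convex_of_good (T : UnrootedBinaryTree V X) [Finite V] [Fintype X] [Nonempty X]
    {P : Finset (Finset X)}
    (hP : GoodPart (PathInter T) Finset.univ P) : IsCharacter P ∧ IsConvexChar T P := by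
  classical
  have hI := inter_leafLike T
  refine ⟨⟨hP.1, ?_, fun x => (hP.2.1 x).1 (Finset.mem_univ x)⟩, ?_⟩
  · intro A hA B hB hne
    rw [Finset.disjoint_left]
    intro x hx hx'
    exact hne (hP.uniq hI hA hB hx hx')
  have hG := T.isTree
  -- representative of each block
  let rep : Finset X → X := fun B => if h : B.Nonempty then h.choose else Classical.arbitrary X
  have hrep : ∀ B ∈ P, rep B ∈ B := by
    intro B hB
    have := hP.1 B hB
    simp only [rep, this, dif_pos]
    exact this.choose_spec
  -- hulls
  let H : Finset X → V → Prop := fun B v => B ∈ P ∧ ∃ x ∈ B, TBtw T.graph (T.label x) v (T.label (rep B))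
  have hH : ∀ A B v, H A v → H B v → A = B := by
    rintro A B v ⟨hA, x, hx, h1⟩ ⟨hB, y, hy, h2⟩
    exact hP.2.2 A hA B hB x hx _ (hrep A hA) y hy _ (hrep B hB) ⟨v, h1, h2⟩
  let S : Set V := {v | ∃ B, H B v}
  let h : V → Finset X := fun v => if hv : ∃ B, H B v then hv.choose else ∅
  have hh : ∀ B v, H B v → h v = B := by
    intro B v hv
    have hex : ∃ B, H B v := ⟨B, hv⟩
    simp only [h, hex, dif_pos]
    exact hH _ _ v hex.choose_spec hv
  have hlab : ∀ x, ∀ B ∈ P, x ∈ B → H B (T.label x) := fun x B hB hx => ⟨hB, x, hx, btw_left _ _⟩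
  obtain ⟨x0⟩ := ‹Nonempty X›
  obtain ⟨B0, hB0, hx0⟩ := (hP.2.1 x0).1 (Finset.mem_univ _)
  obtain ⟨h', h1, h2, h3⟩ := extend_colouring hG.connected (fun B => T.label (rep B)) _ S h
    ⟨_, B0, hlab x0 B0 hB0 hx0⟩ rfl (by
      rintro v ⟨B, hv⟩
      rw [hh B v hv]
      obtain ⟨hB, x, hx, hb⟩ := hv
      obtain ⟨p, hp, hu⟩ := hG.existsUnique_path (T.label x) (T.label (rep B))
      refine ⟨p.dropUntil v (hb p), fun w hw => ?_⟩
      have hwp : w ∈ p.support := Walk.support_dropUntil_subset_support _ (hb p) hw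
      have hHw : H B w := by
        refine ⟨hB, x, hx, fun q => ?_⟩
        apply q.support_bypass_subset_support
        rw [hu q.bypass q.bypass_isPath]
        exact hwp
      exact ⟨⟨B, hHw⟩, hh B w hHw⟩)
  have hlab' : ∀ (x : X) (B : Finset X), B ∈ P → x ∈ B → h' (T.label x) = B := by
    intro x B hB hx
    rw [h1 _ ⟨B, hlab x B hB hx⟩, hh B _ (hlab x B hB hx)]
  refine ⟨h', ?_, hlab', ?_⟩
  · intro v
    obtain ⟨u, ⟨B, hu⟩, e⟩ := h2 v
    rw [e, hh B u hu]
    exact hu.1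
  · intro B hB
    refine connected_of_walks (T.label (rep B)) (hlab' _ B hB (hrep B hB)) ?_
    rintro v rfl
    exact h3 v

end Link

/-- the number of convex characters with exactly `r` states on a tree
with `n` taxa is `C(2n-r-1, r-1)`, independent of topology. -/
theorem g1_count_eq_choose {V X : Type} [Finite V] [Finite X]
    (T : UnrootedBinaryTree V X) (n r : ℕ) (hn : Nat.card X = n)
    (hn2 : 2 ≤ n) (hr : 1 ≤ r) :
    gCount T 1 r = Nat.choose (2 * n - r - 1) (r - 1) := by
  classical
  have : Fintype X := Fintype.ofFinite X
  have : Nonempty X := by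
    have : 0 < Nat.card X := by omega
    exact (Nat.card_pos_iff.1 this).1
  have hcard := gparts_card (inter_leafLike T) (inter_cherry T) n Finset.univ r
    (by rw [Finset.card_univ, ← Nat.card_eq_fintype_card, hn])
  have hg : gCount T 1 r = (gparts (PathInter T) Finset.univ r).card := by
    unfold gCount
    rw [← Nat.card_eq_finsetCard]
    refine Nat.card_congr (Equiv.subtypeEquivRight fun P => ?_)
    rw [mem_gparts]
    constructor
    · rintro ⟨h1, h2, h3, -⟩
      exact ⟨good_of_convex T h1 h2, h3⟩
    · rintro ⟨h1, h2⟩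
      obtain ⟨h3, h4⟩ := convex_of_good T h1
      exact ⟨h3, h4, h2, fun B hB => Finset.card_pos.2 (h3.1 B hB)⟩
  rw [hg, hcard]
  obtain ⟨k, rfl⟩ : ∃ k, n = k + 1 := ⟨n - 1, by omega⟩
  obtain ⟨s, rfl⟩ : ∃ s, r = s + 1 := ⟨r - 1, by omega⟩
  simp only [fcount]
  congr 1
  omega
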